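/- Let E be a real normed vector space, let f, g : E → ℝ be functions differentiable at θ ∈ E with f θ > 0 and g θ > 0, let c_w, c_l > 0, β ∈ ℝ and a, b > 0. Define the energy-factor penalized DPO loss L : E → ℝ by L(θ') = −log (σ (a * β * log (f θ' / c_w) − b * β * log (g θ' / c_l))), where σ(x) = 1 / (1 + exp(−x)), and set ρ̃ = a * β * log (f θ / c_w) − b * β * log (g θ / c_l). Then L is differentiable at θ and fderiv L θ = −β * σ(−ρ̃) • (a * (1 / f θ) • fderiv f θ − b * (1 / g θ) • fderiv g θ); i.e. the individual factors a and b carry onto their respective chosen and rejected policy-gradient terms. -/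

import Mathlib

noncomputable def sigma (x : ℝ) : ℝ := 1 / (1 + Real.exp (-x))

theorem sigma_eq_sigmoid : sigma = Real.sigmoid :=
  funext fun x => one_div (1 + Real.exp (-x))

theorem hasDerivAt_neg_log_sigma (x : ℝ) :
    HasDerivAt (fun y => -Real.log (sigma y)) (-sigma (-x)) x := by
  have hx : Real.sigmoid x ≠ 0 := (Real.sigmoid_pos x).ne'
  rw [sigma_eq_sigmoid, Real.sigmoid_neg]
  refine ((Real.hasDerivAt_sigmoid x).log hx).neg.congr_deriv ?_
  field_simp

theorem hasFDerivAt_log_div_const {E : Type*} [NormedAddCommGroup E] [NormedSpace ℝ E]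
    {f : E → ℝ} {θ : E} {c : ℝ} (hf : DifferentiableAt ℝ f θ) (hfθ : f θ ≠ 0) (hc : c ≠ 0) :
    HasFDerivAt (fun θ' => Real.log (f θ' / c)) ((1 / f θ) • fderiv ℝ f θ) θ := by
  have hlog : HasDerivAt (fun y => Real.log (y / c)) (1 / f θ) (f θ) := by
    convert ((hasDerivAt_id' (f θ)).div_const c).log (div_ne_zero hfθ hc) using 1
    field_simp
  exact hlog.comp_hasFDerivAt θ hf.hasFDerivAt

/-- The Energy Factor penalized DPO gradient formula: the loss
`L θ' = −log σ(a β log (f θ'/c_w) − b β log (g θ'/c_l))` is differentiable at `θ` with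
derivative `−β σ(−ρ̃) • (a (1/f θ) • fderiv f θ − b (1/g θ) • fderiv g θ)`:
the factors `a`, `b` carry onto their respective policy-gradient terms. -/
theorem energy_factor_dpo_gradient {E : Type*} [NormedAddCommGroup E] [NormedSpace ℝ E]
    (f g : E → ℝ) (θ : E)
    (hf : DifferentiableAt ℝ f θ) (hg : DifferentiableAt ℝ g θ)
    (hfθ : 0 < f θ) (hgθ : 0 < g θ)
    (cw cl : ℝ) (hcw : 0 < cw) (hcl : 0 < cl) (β : ℝ)
    (a b : ℝ) (ha : 0 < a) (hb : 0 < b)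
    (L : E → ℝ)
    (hL : ∀ θ', L θ' =
      -Real.log (sigma (a * β * Real.log (f θ' / cw) - b * β * Real.log (g θ' / cl))))
    (ρt : ℝ) (hρt : ρt = a * β * Real.log (f θ / cw) - b * β * Real.log (g θ / cl)) :
    HasFDerivAt L
      ((-(β * sigma (-ρt))) •
        ((a * (1 / f θ)) • fderiv ℝ f θ - (b * (1 / g θ)) • fderiv ℝ g θ)) θ := by
  obtain rfl : L = _ := funext hL
  have hρ := ((hasFDerivAt_log_div_const hf hfθ.ne' hcw.ne').const_mul (a * β)).sub
    ((hasFDerivAt_log_div_const hg hgθ.ne' hcl.ne').const_mul (b * β))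
  subst hρt
  refine ((hasDerivAt_neg_log_sigma _).comp_hasFDerivAt θ hρ).congr_fderiv ?_
  dsimp only [Pi.sub_apply]
  module
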